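/- Let a(n) be the cubic partition function. Then for every nonnegative integer n, a(25n+22) ≡ 0 (mod 5). -/

import Mathlib

/-- The cubic partition function: number of pairs of partitions (λ, μ) with
|λ| + |μ| = n where all parts of μ are even. -/
def cubicPartition (n : ℕ) : ℕ :=
  ∑ j ∈ Finset.range (n + 1),
    Fintype.card (Nat.Partition j) *
      Fintype.card {μ : Nat.Partition (n - j) // ∀ i ∈ μ.parts, Even i}

open PowerSeries

/-- The Euler operator `q d/dq` on power series. -/
noncomputable def eulerD (R : Type*) [CommRing R] : Derivation R R⟦X⟧ R⟦X⟧ :=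
  (X : R⟦X⟧) • PowerSeries.derivative R

theorem coeff_eulerD {R : Type*} [CommRing R] (f : R⟦X⟧) (n : ℕ) :
    coeff n (eulerD R f) = n * coeff n f := by
  cases n with
  | zero => simp [eulerD]
  | succ n => simp [eulerD, coeff_succ_X_mul, coeff_derivative, mul_comm]

instance fact_prime_five : Fact (Nat.Prime 5) := ⟨by norm_num⟩

instance charP_powerSeries_zmod_five : CharP (ZMod 5)⟦X⟧ 5 :=
  charP_of_injective_algebraMap (algebraMap (ZMod 5) (ZMod 5)⟦X⟧).injective 5

theorem expand_five_eq_pow (f : (ZMod 5)⟦X⟧) :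
    expand 5 (by norm_num) f = f ^ 5 := by
  have h := MvPowerSeries.map_frobenius_expand (p := 5) (by norm_num) (f := f)
  rw [ZMod.frobenius_zmod] at h
  rw [← h]
  ext n
  rfl

/-- All exponents occurring in `f` lie in the residue class `c` modulo `5`. -/
def SupportedMod (c : ZMod 5) (f : (ZMod 5)⟦X⟧) : Prop :=
  ∀ n : ℕ, (n : ZMod 5) ≠ c → coeff n f = 0

namespace SupportedMod

variable {a b c : ZMod 5} {f g : (ZMod 5)⟦X⟧}

theorem mul (hf : SupportedMod a f) (hg : SupportedMod b g) : SupportedMod (a + b) (f * g) := by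
  intro n hn
  rw [coeff_mul]
  refine Finset.sum_eq_zero fun p hp => ?_
  rw [Finset.HasAntidiagonal.mem_antidiagonal] at hp
  by_cases h : (p.1 : ZMod 5) = a
  · rw [hg p.2, mul_zero]
    rintro rfl
    apply hn
    rw [← hp, ← h]
    push_cast
    rfl
  · rw [hf p.1 h, zero_mul]

theorem one : SupportedMod 0 1 := by
  intro n hn
  rw [coeff_one, if_neg]
  rintro rfl
  simp at hn

theorem pow (hf : SupportedMod a f) (k : ℕ) : SupportedMod (k * a) (f ^ k) := by
  induction k with
  | zero => simpa using one
  | succ k ih =>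
    have := ih.mul hf
    rw [← pow_succ] at this
    convert this using 1
    push_cast
    ring

theorem pow_five (f : (ZMod 5)⟦X⟧) : SupportedMod 0 (f ^ 5) := by
  intro n hn
  rw [← expand_five_eq_pow, coeff_expand_of_not_dvd]
  rwa [← ZMod.natCast_eq_zero_iff]

end SupportedMod

section PolynomialRelations

variable {R : Type*} [CommRing R] [CharP R 5]

theorem cubic_factor (u v : R)
    (h : (u * (1 + 2 * u)) ^ 2 =
      2 * v * (1 + v) * (1 + 2 * u ^ 2 - u * v - 4 * v ^ 2 - 2 * u + 2 * v)) :
    (2 + 4 * u + 2 * v) * ((1 + u - v) ^ 3 + 2 * (1 + u - v) + 2 - v) = 0 := by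
  grind

theorem cube_relation (u v x y : R) (h : (1 + u - v) ^ 3 + 2 * (1 + u - v) + 2 - v = 0)
    (hx : x = -(u * (1 + 2 * u))) (hy : y = 2 * v * (1 + v)) :
    ((9 * u ^ 2 * (1 + v) - v * (1 - 3 * u) ^ 2) *
      ((1 - 3 * u) * (1 + v) ^ 2 + 3 * u * v ^ 2)) ^ 3 = (x * y) ^ 2 := by
  obtain ⟨A, hA⟩ : ∃ A, A = 1 + u - v := ⟨_, rfl⟩
  have hv : v = A ^ 3 + 2 * A + 2 := by grind
  have hu : u = A ^ 3 + 3 * A + 1 := by grind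
  clear h hA
  obtain ⟨a, ha⟩ : ∃ a, a = 3 + 3 * A ^ 2 := ⟨_, rfl⟩
  obtain ⟨b, hb⟩ : ∃ b, b = 3 - 3 * A ^ 2 := ⟨_, rfl⟩
  have h1 : x = a ^ 2 * b := by grind
  have h2 : y = a * b ^ 2 := by grind
  have h3 : 9 * u ^ 2 * (1 + v) - v * (1 - 3 * u) ^ 2 = b ^ 2 := by grind
  have h4 : (1 - 3 * u) * (1 + v) ^ 2 + 3 * u * v ^ 2 = a ^ 2 := by grind
  rw [h1, h2, h3, h4]
  grind

theorem dissection_rescale (a b u v : R) :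
    ((3 * a * u) ^ 2 * (b - 3 * (3 * b * v)) + (a - 3 * a * u) ^ 2 * (3 * (3 * b * v))) *
      ((a - 3 * a * u) * (b - 3 * (3 * b * v)) ^ 2 + 3 * a * u * (3 * (3 * b * v)) ^ 2) =
    (a * b) ^ 3 * ((9 * u ^ 2 * (1 + v) - v * (1 - 3 * u) ^ 2) *
      ((1 - 3 * u) * (1 + v) ^ 2 + 3 * u * v ^ 2)) := by
  grind

end PolynomialRelations

theorem eq_X_sq_mul_of_pow_three_eq {L r : (ZMod 5)⟦X⟧} (hr : constantCoeff r ≠ 0)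
    (h : L ^ 3 = (X ^ 2 * r) ^ 3) : L = X ^ 2 * r := by
  obtain ⟨l, rfl⟩ : X ^ 2 ∣ L := by
    rw [← UniqueFactorizationMonoid.pow_dvd_pow_iff_dvd three_ne_zero, h, mul_pow]
    exact dvd_mul_right _ _
  have h3 : l ^ 3 = r ^ 3 := by
    rw [mul_pow, mul_pow] at h
    exact mul_left_cancel₀ (by simp [X_ne_zero]) h
  have hc : constantCoeff l = constantCoeff r := by
    have := congrArg constantCoeff h3
    rw [map_pow, map_pow] at this
    revert this
    generalize constantCoeff l = s
    generalize constantCoeff r = t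
    revert s t
    decide
  have hprod : (l - r) * (l ^ 2 + l * r + r ^ 2) = 0 := by linear_combination h3
  rcases mul_eq_zero.1 hprod with h0 | h0
  · rw [sub_eq_zero.1 h0]
  · exfalso
    have := congrArg constantCoeff h0
    simp only [map_add, map_mul, map_pow, hc, map_zero] at this
    revert this hr
    generalize constantCoeff r = t
    revert t
    decide

section Dissection

local notation "θ" => eulerD (ZMod 5)

variable {e d f : (ZMod 5)⟦X⟧}

theorem dissection_product (he0 : constantCoeff e = 1) (hd0 : constantCoeff d = 1)
    (he : θ (θ e) = 2 * θ e + X * e ^ 25) (hd : θ (θ d) = 4 * θ d + 4 * X ^ 2 * d ^ 25)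
    (he3 : θ (θ (e ^ 3)) = θ (e ^ 3)) (hd3 : θ (θ (d ^ 3)) = 2 * θ (d ^ 3))
    (hf : f * d = e ^ 2) (hf2 : θ (θ f) = f - f ^ 25) :
    (θ (e ^ 3) ^ 2 * (d ^ 3 - 3 * θ (d ^ 3)) + (e ^ 3 - θ (e ^ 3)) ^ 2 * (3 * θ (d ^ 3))) *
    ((e ^ 3 - θ (e ^ 3)) * (d ^ 3 - 3 * θ (d ^ 3)) ^ 2 + θ (e ^ 3) * (3 * θ (d ^ 3)) ^ 2) =
    X ^ 2 * (e * d) ^ 25 := by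
  have h5 : (5 : (ZMod 5)⟦X⟧) = 0 := by exact_mod_cast CharP.cast_eq_zero (ZMod 5)⟦X⟧ 5
  have hene : e ≠ 0 := by rintro rfl; simp at he0
  have hdne : d ≠ 0 := by rintro rfl; simp at hd0
  have hfne : f ≠ 0 := by rintro rfl; simp [hene, eq_comm] at hf
  have h3 : (3 : (ZMod 5)⟦X⟧) ≠ 0 := by
    intro h
    have := congrArg constantCoeff h
    rw [map_ofNat, map_zero] at this
    exact absurd this (by decide)
  obtain ⟨u, hu⟩ : ∃ u, θ e = e * u :=
    ⟨e⁻¹ * θ e, by rw [← mul_assoc, PowerSeries.mul_inv_cancel _ (by simp [he0]), one_mul]⟩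
  obtain ⟨v, hv⟩ : ∃ v, θ d = d * v :=
    ⟨d⁻¹ * θ d, by rw [← mul_assoc, PowerSeries.mul_inv_cancel _ (by simp [hd0]), one_mul]⟩
  have hcθ (g : (ZMod 5)⟦X⟧) : constantCoeff (θ g) = 0 := by
    rw [← coeff_zero_eq_constantCoeff_apply, coeff_eulerD]; simp
  have hu0 : constantCoeff u = 0 := by
    simpa [hcθ, he0, eq_comm] using congrArg constantCoeff hu
  have hv0 : constantCoeff v = 0 := by
    simpa [hcθ, hd0, eq_comm] using congrArg constantCoeff hv
  have hs : θ (e ^ 3) = 3 * e ^ 3 * u := by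
    rw [Derivation.leibniz_pow, hu]; simp only [smul_eq_mul, nsmul_eq_mul]; push_cast; ring
  have ht : θ (d ^ 3) = 3 * d ^ 3 * v := by
    rw [Derivation.leibniz_pow, hv]; simp only [smul_eq_mul, nsmul_eq_mul]; push_cast; ring
  have hθ3 : θ 3 = 0 := Derivation.map_natCast _ 3
  have hu' : θ u = u - 3 * u ^ 2 := by
    apply mul_left_cancel₀ (mul_ne_zero h3 (pow_ne_zero 3 hene))
    rw [hs] at he3
    simp only [Derivation.leibniz, hs, hθ3, smul_eq_mul] at he3
    linear_combination he3
  have hv' : θ v = 2 * v - 3 * v ^ 2 := by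
    apply mul_left_cancel₀ (mul_ne_zero h3 (pow_ne_zero 3 hdne))
    rw [ht] at hd3
    simp only [Derivation.leibniz, ht, hθ3, smul_eq_mul] at hd3
    linear_combination hd3
  have hx : X * e ^ 24 = -(u * (1 + 2 * u)) := by
    apply mul_left_cancel₀ hene
    rw [hu] at he
    simp only [Derivation.leibniz, hu, hu', smul_eq_mul] at he
    linear_combination -he
  have hy : X ^ 2 * d ^ 24 = 2 * v * (1 + v) := by
    apply mul_left_cancel₀ hdne
    rw [hv] at hd
    simp only [Derivation.leibniz, hv, hv', smul_eq_mul] at hd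
    linear_combination -4*hd - (3*X^2*d^25+2*d*v+2*d*v^2)*h5
  have hfθ : θ f = f * (2 * u - v) := by
    apply mul_right_cancel₀ hdne
    have := congrArg θ hf
    rw [Derivation.leibniz, Derivation.leibniz_pow, hu, hv] at this
    simp only [smul_eq_mul, nsmul_eq_mul] at this
    push_cast at this
    linear_combination this - 2 * u * hf
  have hθ2 : θ 2 = 0 := Derivation.map_natCast _ 2
  have hf24 : f ^ 24 = 1 + 2 * u ^ 2 - u * v - 4 * v ^ 2 - 2 * u + 2 * v := by
    apply mul_left_cancel₀ hfne
    rw [hfθ] at hf2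
    simp only [Derivation.leibniz, map_sub, hfθ, hu', hv', hθ2, smul_eq_mul] at hf2
    linear_combination hf2 + f*u*v*h5
  have hquartic : (u * (1 + 2 * u)) ^ 2 =
      2 * v * (1 + v) * (1 + 2 * u ^ 2 - u * v - 4 * v ^ 2 - 2 * u + 2 * v) := by
    rw [← hf24, ← hy, ← neg_sq, ← hx]
    calc (X * e ^ 24) ^ 2 = X ^ 2 * (e ^ 2) ^ 24 := by ring
      _ = X ^ 2 * (f * d) ^ 24 := by rw [hf]
      _ = _ := by ring
  have hcubic : (1 + u - v) ^ 3 + 2 * (1 + u - v) + 2 - v = 0 := by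
    refine (mul_eq_zero.1 (cubic_factor u v hquartic)).resolve_left fun h => ?_
    have := congrArg constantCoeff h
    simp only [map_add, map_mul, map_ofNat, hu0, hv0, map_zero] at this
    exact absurd this (by decide)
  have hcube := cube_relation u v _ _ hcubic hx hy
  have hL := eq_X_sq_mul_of_pow_three_eq (r := (e * d) ^ 16) (by simp [he0, hd0])
    (hcube.trans (by ring))
  rw [hs, ht, dissection_rescale, hL]
  ring

end Dissection

section Extraction

local notation "θ" => eulerD (ZMod 5)

variable {e d g : (ZMod 5)⟦X⟧}

theorem SupportedMod.eulerD_of_eulerD_eulerD {F : (ZMod 5)⟦X⟧} {c : ZMod 5}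
    (h : θ (θ F) = C c * θ F) : SupportedMod c (θ F) := by
  intro n hn
  have := congrArg (coeff n) h
  rw [coeff_eulerD, coeff_C_mul] at this
  exact (mul_eq_zero.1 (by linear_combination this : ((n : ZMod 5) - c) * coeff n (θ F) = 0)
    ).resolve_left (sub_ne_zero.2 hn)

theorem SupportedMod.sub_eulerD_of_eulerD_eulerD {F : (ZMod 5)⟦X⟧} {c b : ZMod 5}
    (hb : b * c = 1) (h : θ (θ F) = C c * θ F) : SupportedMod 0 (F - C b * θ F) := by
  intro n hn
  have := congrArg (coeff n) h
  rw [coeff_eulerD, coeff_C_mul, coeff_eulerD] at this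
  rw [map_sub, coeff_C_mul, coeff_eulerD]
  have h1 : (n : ZMod 5) * (coeff n F - b * (n * coeff n F)) = 0 := by
    linear_combination -b * this - (n : ZMod 5) * coeff n F * hb
  exact (mul_eq_zero.1 h1).resolve_left hn

theorem coeff_cube_mul_cube {S₀ S₁ T₀ T₂ w : (ZMod 5)⟦X⟧} (hS₀ : SupportedMod 0 S₀)
    (hS₁ : SupportedMod 1 S₁) (hT₀ : SupportedMod 0 T₀) (hT₂ : SupportedMod 2 T₂)
    (hw : SupportedMod 0 w) {n : ℕ} (hn : (n : ZMod 5) = 2) :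
    coeff n (w * ((S₀ + S₁) ^ 3 * (T₀ + T₂) ^ 3)) =
      coeff n (w * (3 * ((S₁ ^ 2 * T₀ + S₀ ^ 2 * T₂) * (S₀ * T₀ ^ 2 + S₁ * T₂ ^ 2)))) := by
  have key (i j a b : ℕ) (hij : (i + 2 * j : ZMod 5) ≠ 2) (c : ZMod 5) :
      coeff n (C c * (w * (S₀ ^ a * S₁ ^ i * (T₀ ^ b * T₂ ^ j)))) = 0 := by
    rw [coeff_C_mul, hw.mul (((hS₀.pow a).mul (hS₁.pow i)).mul ((hT₀.pow b).mul (hT₂.pow j))) n,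
      mul_zero]
    rw [hn]
    contrapose! hij
    linear_combination -hij
  rw [← sub_eq_zero, ← map_sub]
  have : w * ((S₀ + S₁) ^ 3 * (T₀ + T₂) ^ 3) -
      w * (3 * ((S₁ ^ 2 * T₀ + S₀ ^ 2 * T₂) * (S₀ * T₀ ^ 2 + S₁ * T₂ ^ 2))) =
      C 1 * (w * (S₀ ^ 3 * S₁ ^ 0 * (T₀ ^ 3 * T₂ ^ 0))) +
      C 3 * (w * (S₀ ^ 1 * S₁ ^ 2 * (T₀ ^ 2 * T₂ ^ 1))) * 3 +
      C 3 * (w * (S₀ ^ 1 * S₁ ^ 2 * (T₀ ^ 1 * T₂ ^ 2))) * 3 +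
      C 3 * (w * (S₀ ^ 1 * S₁ ^ 2 * (T₀ ^ 0 * T₂ ^ 3))) +
      C 1 * (w * (S₀ ^ 3 * S₁ ^ 0 * (T₀ ^ 1 * T₂ ^ 2))) * 3 +
      C 1 * (w * (S₀ ^ 3 * S₁ ^ 0 * (T₀ ^ 0 * T₂ ^ 3))) +
      C 3 * (w * (S₀ ^ 2 * S₁ ^ 1 * (T₀ ^ 3 * T₂ ^ 0))) +
      C 3 * (w * (S₀ ^ 2 * S₁ ^ 1 * (T₀ ^ 2 * T₂ ^ 1))) * 3 +
      C 3 * (w * (S₀ ^ 2 * S₁ ^ 1 * (T₀ ^ 1 * T₂ ^ 2))) * 3 +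
      C 1 * (w * (S₀ ^ 0 * S₁ ^ 3 * (T₀ ^ 3 * T₂ ^ 0))) +
      C 1 * (w * (S₀ ^ 0 * S₁ ^ 3 * (T₀ ^ 2 * T₂ ^ 1))) * 3 +
      C 1 * (w * (S₀ ^ 0 * S₁ ^ 3 * (T₀ ^ 0 * T₂ ^ 3))) := by
    have h3 : C (3 : ZMod 5) = 3 := map_ofNat _ 3
    rw [h3, map_one]
    ring
  have hC : (3 : (ZMod 5)⟦X⟧) = C 3 := (map_ofNat _ 3).symm
  rw [this, hC]
  simp only [map_add, coeff_mul_C]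
  rw [key 0 0 _ _ (by decide), key 2 1 _ _ (by decide), key 2 2 _ _ (by decide),
    key 2 3 _ _ (by decide), key 0 2 _ _ (by decide), key 0 3 _ _ (by decide),
    key 1 0 _ _ (by decide), key 1 1 _ _ (by decide), key 1 2 _ _ (by decide),
    key 3 0 _ _ (by decide), key 3 1 _ _ (by decide), key 3 3 _ _ (by decide)]
  simp

theorem coeff_mul_four_mod_five {S₀ S₁ T₀ T₂ : (ZMod 5)⟦X⟧} (hS₀ : SupportedMod 0 S₀)
    (hS₁ : SupportedMod 1 S₁) (hT₀ : SupportedMod 0 T₀) (hT₂ : SupportedMod 2 T₂)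
    {n : ℕ} (hn : (n : ZMod 5) = 4) : coeff n ((S₀ + S₁) * (T₀ + T₂)) = 0 := by
  rw [add_mul, mul_add, mul_add, map_add, map_add, map_add, hS₀.mul hT₀ n, hS₀.mul hT₂ n,
    hS₁.mul hT₀ n, hS₁.mul hT₂ n]
  · simp
  all_goals rw [hn]; decide

theorem coeff_eq_zero_of_dissection {f : (ZMod 5)⟦X⟧}
    (he0 : constantCoeff e = 1) (hd0 : constantCoeff d = 1)
    (he : θ (θ e) = 2 * θ e + X * e ^ 25) (hd : θ (θ d) = 4 * θ d + 4 * X ^ 2 * d ^ 25)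
    (he3 : θ (θ (e ^ 3)) = θ (e ^ 3)) (hd3 : θ (θ (d ^ 3)) = 2 * θ (d ^ 3))
    (hf : f * d = e ^ 2) (hf2 : θ (θ f) = f - f ^ 25) (hg : g * (e * d) = 1) (n : ℕ) :
    coeff (25 * n + 22) g = 0 := by
  have h2 : C (2 : ZMod 5) = 2 := map_ofNat _ 2
  have h3 : C (3 : ZMod 5) = 3 := map_ofNat _ 3
  have hprod := dissection_product he0 hd0 he hd he3 hd3 hf hf2
  have hS₁ : SupportedMod 1 (θ (e ^ 3)) :=
    .eulerD_of_eulerD_eulerD (by rw [he3, map_one, one_mul])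
  have hS₀ : SupportedMod 0 (e ^ 3 - θ (e ^ 3)) := by
    have := SupportedMod.sub_eulerD_of_eulerD_eulerD (F := e ^ 3) (one_mul 1)
      (by rw [he3, map_one, one_mul])
    rwa [map_one, one_mul] at this
  have hT : SupportedMod 2 (θ (d ^ 3)) :=
    .eulerD_of_eulerD_eulerD (by rw [hd3, h2])
  have hT₂ : SupportedMod 2 (3 * θ (d ^ 3)) := by
    intro m hm
    rw [← h3, coeff_C_mul, hT m hm, mul_zero]
  have hT₀ : SupportedMod 0 (d ^ 3 - 3 * θ (d ^ 3)) := by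
    rw [← h3]
    exact SupportedMod.sub_eulerD_of_eulerD_eulerD (c := 2) (b := 3) (by decide) (by rw [hd3, h2])
  have hg' : g = (g ^ 2) ^ 5 * ((e ^ 3 - θ (e ^ 3) + θ (e ^ 3)) ^ 3 *
      (d ^ 3 - 3 * θ (d ^ 3) + 3 * θ (d ^ 3)) ^ 3) := by
    rw [sub_add_cancel, sub_add_cancel]
    calc g = g * (g * (e * d)) ^ 9 := by rw [hg]; ring
      _ = _ := by ring
  have hn : ((25 * n + 22 : ℕ) : ZMod 5) = 2 := by
    push_cast
    rw [show (25 : ZMod 5) = 0 from rfl, zero_mul, zero_add]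
    rfl
  rw [hg', coeff_cube_mul_cube hS₀ hS₁ hT₀ hT₂ (.pow_five _) hn, hprod]
  have : (g ^ 2) ^ 5 * (3 * (X ^ 2 * (e * d) ^ 25)) = C 3 * (X ^ 2 * (e ^ 3 * d ^ 3) ^ 5) := by
    rw [h3]
    calc _ = (g * (e * d)) ^ 10 * (3 * (X ^ 2 * (e ^ 3 * d ^ 3) ^ 5)) := by ring
      _ = _ := by rw [hg]; ring
  rw [this, coeff_C_mul, show 25 * n + 22 = (25 * n + 20) + 2 by ring, coeff_X_pow_mul,
    ← expand_five_eq_pow, show 25 * n + 20 = 5 * (5 * n + 4) by ring, coeff_expand_mul]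
  have h4 := coeff_mul_four_mod_five hS₀ hS₁ hT₀ hT₂ (n := 5 * n + 4) (by
    push_cast
    rw [show (5 : ZMod 5) = 0 from rfl, zero_mul, zero_add])
  rw [sub_add_cancel, sub_add_cancel] at h4
  rw [h4, mul_zero]

end Extraction

section Pentagonal

theorem expand_twentyFive_eq_pow (f : (ZMod 5)⟦X⟧) :
    expand 25 (by norm_num) f = f ^ 25 := by
  rw [show f ^ 25 = (f ^ 5) ^ 5 by ring, ← expand_five_eq_pow, ← expand_five_eq_pow, ← expand_mul]

theorem pentagonal_one_sub_five_mul (l : ℤ) :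
    pentagonal (1 - 5 * l) = 25 * pentagonal l + 1 := by
  have h1 := two_mul_natCast_pentagonal (1 - 5 * l)
  have h2 := two_mul_natCast_pentagonal l
  zify
  linarith

theorem coeff_pentagonalSeries_quadratic (m : ℕ) :
    ((m : ZMod 5) ^ 2 - 2 * m) * coeff m (pentagonalSeries (ZMod 5)) =
      coeff m (X * pentagonalSeries (ZMod 5) ^ 25) := by
  rw [← expand_twentyFive_eq_pow]
  by_cases h : ∃ l, m = 25 * pentagonal l + 1
  · obtain ⟨l, rfl⟩ := h
    rw [coeff_succ_X_mul, coeff_expand_mul, ← pentagonal_one_sub_five_mul,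
      coeff_pentagonalSeries_pentagonal, coeff_pentagonalSeries_pentagonal,
      pentagonal_one_sub_five_mul]
    have h25 : (25 : ZMod 5) = 0 := rfl
    push_cast
    rw [h25]
    have : Int.negOnePow (1 - 5 * l) = - Int.negOnePow l := by
      rw [Int.negOnePow_sub, Int.negOnePow_one]
      have : Int.negOnePow (5 * l) = Int.negOnePow l := by
        rw [Int.negOnePow_eq_iff]
        exact ⟨2 * l, by ring⟩
      rw [this]; simp
    simp [this]
    ring
  · have hR : coeff m (X * expand 25 (by norm_num) (pentagonalSeries (ZMod 5))) = 0 := by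
      rcases m with _ | m
      · simp
      rw [coeff_succ_X_mul, coeff_expand]
      split_ifs with h25
      · obtain ⟨p, rfl⟩ := h25
        rw [Nat.mul_div_cancel_left _ (by norm_num)]
        apply coeff_pentagonalSeries_eq_zero
        rintro ⟨l, rfl⟩
        exact h ⟨l, rfl⟩
      · rfl
    rw [hR]
    by_cases hm : m ∈ Set.range pentagonal
    · obtain ⟨k, rfl⟩ := hm
      have hk : (k : ZMod 5) ≠ 1 := by
        intro hk
        have : ((k - 1 : ℤ) : ZMod 5) = 0 := by push_cast; rw [hk]; ring
        obtain ⟨l, hl⟩ := (ZMod.intCast_zmod_eq_zero_iff_dvd _ 5).1 this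
        refine h ⟨-l, ?_⟩
        rw [← pentagonal_one_sub_five_mul]
        congr 1
        push_cast at hl
        linarith
      have h2 : (2 : ZMod 5) * pentagonal k = k * (3 * k - 1) := by
        exact_mod_cast congrArg (Int.cast (R := ZMod 5)) (two_mul_natCast_pentagonal k)
      have : ((pentagonal k : ℕ) : ZMod 5) ^ 2 - 2 * (pentagonal k : ℕ) = 0 := by
        revert h2 hk
        generalize (k : ZMod 5) = a
        generalize ((pentagonal k : ℕ) : ZMod 5) = b
        revert a b
        decide
      rw [this, zero_mul]
    · rw [coeff_pentagonalSeries_eq_zero _ hm, mul_zero]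

local notation "θ" => eulerD (ZMod 5)

theorem eulerD_eulerD_pentagonalSeries :
    θ (θ (pentagonalSeries (ZMod 5))) =
      2 * θ (pentagonalSeries (ZMod 5)) + X * pentagonalSeries (ZMod 5) ^ 25 := by
  ext m
  have h2 : (2 : (ZMod 5)⟦X⟧) = C 2 := (map_ofNat _ 2).symm
  rw [map_add, ← coeff_pentagonalSeries_quadratic, h2, coeff_C_mul, coeff_eulerD, coeff_eulerD]
  ring

theorem eulerD_expand_two (f : (ZMod 5)⟦X⟧) :
    θ (expand 2 two_ne_zero f) = 2 * expand 2 two_ne_zero (θ f) := by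
  have h2 : (2 : (ZMod 5)⟦X⟧) = C 2 := (map_ofNat _ 2).symm
  ext m
  rw [coeff_eulerD, h2, coeff_C_mul, coeff_expand, coeff_expand]
  split_ifs with h
  · obtain ⟨k, rfl⟩ := h
    rw [Nat.mul_div_cancel_left _ (by norm_num), coeff_eulerD]
    push_cast
    ring
  · simp

theorem eulerD_two_mul (f : (ZMod 5)⟦X⟧) : θ (2 * f) = 2 * θ f := by
  rw [Derivation.leibniz, show θ 2 = 0 from Derivation.map_natCast _ 2]
  simp

theorem eulerD_eulerD_expand_pentagonalSeries :
    θ (θ (expand 2 two_ne_zero (pentagonalSeries (ZMod 5)))) =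
      4 * θ (expand 2 two_ne_zero (pentagonalSeries (ZMod 5))) +
        4 * X ^ 2 * expand 2 two_ne_zero (pentagonalSeries (ZMod 5)) ^ 25 := by
  rw [eulerD_expand_two, eulerD_two_mul, eulerD_expand_two, eulerD_eulerD_pentagonalSeries,
    map_add, map_mul, map_mul, map_pow, expand_X, map_ofNat]
  ring

end Pentagonal

section QBinomial

variable {R S : Type*} [CommRing R] [CommRing S]

/-- The Gaussian binomial coefficient evaluated at `q`. -/
def qBinom (q : R) : ℕ → ℕ → R
  | _, 0 => 1
  | 0, _ + 1 => 0
  | n + 1, k + 1 => qBinom q n k + q ^ (k + 1) * qBinom q n (k + 1)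

/-- The finite product `(q; q)_n`. -/
def qFactorial (q : R) (n : ℕ) : R := ∏ i ∈ Finset.range n, (1 - q ^ (i + 1))

theorem qBinom_zero_right (q : R) (n : ℕ) : qBinom q n 0 = 1 := by
  cases n <;> rfl

theorem qBinom_succ_succ (q : R) (n k : ℕ) :
    qBinom q (n + 1) (k + 1) = qBinom q n k + q ^ (k + 1) * qBinom q n (k + 1) := rfl

theorem qBinom_eq_zero_of_lt (q : R) {n k : ℕ} (h : n < k) : qBinom q n k = 0 := by
  induction n generalizing k with
  | zero => obtain ⟨k, rfl⟩ := Nat.exists_eq_succ_of_ne_zero h.ne'; rfl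
  | succ n ih =>
    obtain ⟨k, rfl⟩ := Nat.exists_eq_succ_of_ne_zero (Nat.ne_zero_of_lt h)
    rw [Nat.succ_eq_add_one, qBinom_succ_succ, ih (by omega), ih (by omega)]
    ring

theorem qBinom_self (q : R) (n : ℕ) : qBinom q n n = 1 := by
  induction n with
  | zero => rfl
  | succ n ih => rw [qBinom_succ_succ, ih, qBinom_eq_zero_of_lt q n.lt_succ_self]; ring

theorem map_qBinom (f : R →+* S) (q : R) (n k : ℕ) : f (qBinom q n k) = qBinom (f q) n k := by
  induction n generalizing k with
  | zero => cases k <;> simp [qBinom]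
  | succ n ih => cases k <;> simp [qBinom, ih]

theorem qFactorial_succ (q : R) (n : ℕ) :
    qFactorial q (n + 1) = qFactorial q n * (1 - q ^ (n + 1)) := Finset.prod_range_succ _ _

theorem map_qFactorial (f : R →+* S) (q : R) (n : ℕ) :
    f (qFactorial q n) = qFactorial (f q) n := by
  simp [qFactorial]

theorem qBinom_add_mul_qFactorial (q : R) (i j : ℕ) :
    qBinom q (i + j) i * qFactorial q i * qFactorial q j = qFactorial q (i + j) := by
  induction i generalizing j with
  | zero => simp [qBinom_zero_right, qFactorial]
  | succ i ihi =>
    induction j with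
    | zero => simp [qBinom_self, qFactorial]
    | succ j ihj =>
      have h1 := ihi (j + 1)
      rw [show i + 1 + (j + 1) = (i + (j + 1)) + 1 by ring, qBinom_succ_succ,
        qFactorial_succ q (i + (j + 1)), ← h1]
      rw [show i + 1 + j = i + (j + 1) by ring, ← h1] at ihj
      rw [qFactorial_succ] at ihj ⊢
      rw [qFactorial_succ q j] at ihj ⊢
      linear_combination q ^ (i + 1) * (1 - q ^ (j + 1)) * ihj

theorem prod_add_mul_pow (q x y : R) (n : ℕ) :
    ∏ i ∈ Finset.range n, (y + x * q ^ i) =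
      ∑ k ∈ Finset.range (n + 1), q ^ k.choose 2 * qBinom q n k * x ^ k * y ^ (n - k) := by
  induction n generalizing x with
  | zero => simp [qBinom]
  | succ n ih =>
    have hP : ∏ i ∈ Finset.range n, (y + x * q ^ (i + 1)) =
        ∏ i ∈ Finset.range n, (y + x * q * q ^ i) :=
      Finset.prod_congr rfl fun i _ => by ring
    have hy : y * ∑ k ∈ Finset.range (n + 1),
        q ^ k.choose 2 * qBinom q n k * (x * q) ^ k * y ^ (n - k) =
        ∑ k ∈ Finset.range (n + 2),
          q ^ k.choose 2 * qBinom q n k * (x * q) ^ k * y ^ (n + 1 - k) := by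
      rw [Finset.sum_range_succ _ (n + 1), qBinom_eq_zero_of_lt q n.lt_succ_self, Finset.mul_sum]
      simp only [mul_zero, zero_mul, add_zero]
      refine Finset.sum_congr rfl fun k hk => ?_
      rw [Nat.succ_sub (Finset.mem_range_succ_iff.1 hk), pow_succ]
      ring
    rw [Finset.prod_range_succ', hP, ih, mul_comm, pow_zero, mul_one, add_mul, hy,
      Finset.sum_range_succ', Finset.sum_range_succ' _ (n + 1), Finset.mul_sum]
    rw [add_right_comm, ← Finset.sum_add_distrib]
    congr 1
    · refine Finset.sum_congr rfl fun k _ => ?_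
      rw [qBinom_succ_succ, Nat.add_sub_add_right, Nat.choose_succ_succ' k 1, Nat.choose_one_right]
      ring
    · simp [qBinom_zero_right]

end QBinomial

section Truncation

theorem qFactorial_dvd_sub {m n : ℕ} (h : m ≤ n) {R : Type*} [CommRing R] (q : R) :
    q ^ (m + 1) ∣ qFactorial q n - qFactorial q m := by
  induction n, h using Nat.le_induction with
  | base => simp
  | succ n hmn ih =>
    rw [qFactorial_succ, show qFactorial q n * (1 - q ^ (n + 1)) - qFactorial q m =
      qFactorial q n - qFactorial q m - q ^ (n + 1) * qFactorial q n by ring]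
    exact dvd_sub ih (Dvd.dvd.mul_right (pow_dvd_pow q (by omega)) _)

variable {R : Type*} [CommRing R]

theorem X_pow_dvd_pentagonalSeries_sub (n : ℕ) :
    (X : R⟦X⟧) ^ (n + 1) ∣ pentagonalSeries R - qFactorial X n := by
  rw [X_pow_dvd_iff]
  intro m hm
  obtain ⟨s, hs⟩ := Filter.eventually_atTop.1 (coeff_prod_one_sub_X_pow_eventually_eq R m)
  obtain ⟨N, hN⟩ := s.exists_nat_subset_range
  have h1 := hs (Finset.range (max n N))
    (hN.trans (Finset.range_subset_range.2 (le_max_right n N)))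
  have h2 := X_pow_dvd_iff.1 (qFactorial_dvd_sub (le_max_left n N) (X : R⟦X⟧)) m hm
  rw [map_sub] at h2 ⊢
  rw [← h1]
  exact h2

theorem constantCoeff_pentagonalSeries : constantCoeff (pentagonalSeries R) = 1 := by
  rw [← coeff_zero_eq_constantCoeff_apply, show 0 = pentagonal 0 from rfl,
    coeff_pentagonalSeries_pentagonal]
  simp

theorem isUnit_pentagonalSeries : IsUnit (pentagonalSeries R) := by
  rw [isUnit_iff_constantCoeff, constantCoeff_pentagonalSeries]
  exact isUnit_one

theorem X_pow_dvd_pentagonalSeries_mul_qBinom_sub_one {r i j : ℕ} (hi : r ≤ i) (hj : r ≤ j) :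
    (X : R⟦X⟧) ^ (r + 1) ∣ pentagonalSeries R * qBinom X (i + j) i - 1 := by
  have key (n : ℕ) (hn : r ≤ n) : (X : R⟦X⟧) ^ (r + 1) ∣ pentagonalSeries R - qFactorial X n :=
    (pow_dvd_pow _ (by omega)).trans (X_pow_dvd_pentagonalSeries_sub n)
  rw [← isUnit_pentagonalSeries.dvd_mul_left]
  have := qBinom_add_mul_qFactorial (X : R⟦X⟧) i j
  obtain ⟨a, ha⟩ := key i hi
  obtain ⟨b, hb⟩ := key j hj
  obtain ⟨c, hc⟩ := key (i + j) (by omega)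
  rw [sub_eq_iff_eq_add] at ha hb hc
  set B := qBinom (X : R⟦X⟧) (i + j) i
  refine ⟨B * a * qFactorial X j + B * b * pentagonalSeries R - c, ?_⟩
  linear_combination pentagonalSeries R * B * hb + B * qFactorial X j * ha + this - hc

end Truncation

theorem two_mul_choose_two (k : ℕ) : (2 * (k.choose 2 : ℕ) : ℤ) = k * (k - 1) := by
  induction k with
  | zero => simp
  | succ k ih =>
    rw [Nat.choose_succ_succ' k 1, Nat.choose_one_right]
    push_cast
    linarith

theorem prod_pow_sub_pow {R : Type*} [CommRing R] (q : R) (n : ℕ) :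
    ∏ i ∈ Finset.range n, (q ^ n - q ^ i) = (-1) ^ n * q ^ n.choose 2 * qFactorial q n := by
  have h1 : ((-1) ^ n : R) = ∏ i ∈ Finset.range n, (-1 : R) := by simp
  rw [qFactorial, ← Finset.prod_range_reflect (fun i => 1 - q ^ (i + 1)), Nat.choose_two_right,
    ← Finset.sum_range_id, ← Finset.prod_pow_eq_pow_sum, h1, ← Finset.prod_mul_distrib,
    ← Finset.prod_mul_distrib]
  refine Finset.prod_congr rfl fun i hi => ?_
  obtain ⟨j, rfl⟩ := Nat.exists_eq_add_of_lt (Finset.mem_range.1 hi)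
  rw [show i + j + 1 - 1 - i = j by omega]
  ring

theorem eval_derivative_mul_X_sub_C_mul {R : Type*} [CommRing R] (a : R) (A B : Polynomial R) :
    (Polynomial.derivative (A * (Polynomial.X - Polynomial.C a) * B)).eval a =
      A.eval a * B.eval a := by
  simp

theorem sum_qBinom_eq_qFactorial_sq {R : Type*} [CommRing R] (q : R) (n : ℕ) :
    ∑ k ∈ Finset.range (2 * n + 1), q ^ (k.choose 2 + n * (2 * n - k)) * (-1) ^ k *
      qBinom q (2 * n + 1) k * ((2 * n + 1 - k : ℕ) : R) =
    (-1) ^ n * q ^ (n.choose 2 + n ^ 2) * qFactorial q n ^ 2 := by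
  have h := congrArg (fun p => (Polynomial.derivative p).eval (q ^ n))
    (prod_add_mul_pow (Polynomial.C q) (-1) Polynomial.X (2 * n + 1))
  have hterm (k : ℕ) : Polynomial.C q ^ k.choose 2 * qBinom (Polynomial.C q) (2 * n + 1) k *
      (-1) ^ k * Polynomial.X ^ (2 * n + 1 - k) =
      Polynomial.C (q ^ k.choose 2 * qBinom q (2 * n + 1) k * (-1) ^ k) *
        Polynomial.X ^ (2 * n + 1 - k) := by
    simp [map_qBinom]
  have hfactor (i : ℕ) : Polynomial.X + -1 * Polynomial.C q ^ i =
      Polynomial.X - Polynomial.C (q ^ i) := by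
    rw [map_pow]
    ring
  have hB : ∏ i ∈ Finset.range n, (q ^ n - q ^ (n + 1 + i)) = q ^ n ^ 2 * qFactorial q n := by
    have h1 : q ^ n ^ 2 = ∏ i ∈ Finset.range n, q ^ n := by simp [← pow_mul, sq]
    rw [h1, qFactorial, ← Finset.prod_mul_distrib]
    exact Finset.prod_congr rfl fun i _ => by ring
  simp only [hterm, hfactor] at h
  rw [Polynomial.derivative_sum, Polynomial.eval_finsetSum, Finset.sum_range_succ,
    show 2 * n + 1 = n + 1 + n by ring, Finset.prod_range_add, Finset.prod_range_succ,
    show n + 1 + n = 2 * n + 1 by ring, eval_derivative_mul_X_sub_C_mul,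
    Polynomial.eval_prod, Polynomial.eval_prod] at h
  simp only [Polynomial.eval_sub, Polynomial.eval_X, Polynomial.eval_C,
    Polynomial.derivative_C_mul_X_pow, Polynomial.eval_mul, Polynomial.eval_pow, hB,
    prod_pow_sub_pow, Nat.sub_self, Nat.cast_zero, mul_zero, zero_mul, add_zero] at h
  rw [show (-1) ^ n * q ^ (n.choose 2 + n ^ 2) * qFactorial q n ^ 2 =
    (-1) ^ n * q ^ n.choose 2 * qFactorial q n * (q ^ n ^ 2 * qFactorial q n) by ring, h]
  refine Finset.sum_congr rfl fun k hk => ?_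
  rw [show 2 * n + 1 - k - 1 = 2 * n - k by omega]
  ring

theorem jacobi_exponent (n k : ℕ) (hk : k < 2 * n + 1) :
    ∃ t : ℕ, k.choose 2 + n * (2 * n - k) = n.choose 2 + n ^ 2 + t ∧
      n ≤ t + min k (2 * n + 1 - k) ∧ (2 * t : ℤ) = (n - k) * (n - k + 1) := by
  have h1 := two_mul_choose_two k
  have h2 := two_mul_choose_two n
  have key (j : ℕ) (hj : ((n : ℤ) - k) * (n - k + 1) = (j + 1) * j) :
      k.choose 2 + n * (2 * n - k) = n.choose 2 + n ^ 2 + (j + 1).choose 2 ∧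
      (2 * ((j + 1).choose 2 : ℕ) : ℤ) = (n - k) * (n - k + 1) := by
    have h3 := two_mul_choose_two (j + 1)
    push_cast at h3
    refine ⟨?_, by linarith⟩
    zify [Nat.lt_succ_iff.1 hk]
    linarith
  have hle (j : ℕ) : j ≤ (j + 1).choose 2 := by
    rw [Nat.choose_succ_succ' j 1, Nat.choose_one_right]
    exact Nat.le_add_right _ _
  rcases le_or_gt k n with h | h
  · obtain ⟨j, rfl⟩ := Nat.exists_eq_add_of_le h
    obtain ⟨ha, hb⟩ := key j (by push_cast; ring)
    exact ⟨_, ha, by have := hle j; omega, hb⟩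
  · obtain ⟨j, rfl⟩ := Nat.exists_eq_add_of_lt h
    obtain ⟨ha, hb⟩ := key j (by push_cast; ring)
    exact ⟨_, ha, by have := hle j; omega, hb⟩

theorem coeff_eq_of_X_pow_dvd_sub {R : Type*} [CommRing R] {f g : R⟦X⟧} {n m : ℕ}
    (h : X ^ n ∣ f - g) (hm : m < n) : coeff m f = coeff m g := by
  rw [← sub_eq_zero, ← map_sub]
  exact X_pow_dvd_iff.1 h m hm

theorem coeff_pentagonalSeries_cube {m : ℕ} (h0 : (m : ZMod 5) ≠ 0) (h1 : (m : ZMod 5) ≠ 1) :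
    coeff m (pentagonalSeries (ZMod 5) ^ 3) = 0 := by
  set e := pentagonalSeries (ZMod 5) with he
  obtain ⟨n, hmn, hn⟩ : ∃ n : ℕ, m ≤ n ∧ (n : ZMod 5) = 2 := by
    refine ⟨5 * m + 2, by omega, ?_⟩
    push_cast
    rw [show (5 : ZMod 5) = 0 from rfl, zero_mul, zero_add]
  choose! t ht1 ht2 ht3 using jacobi_exponent n
  have hsum : (-1) ^ n * qFactorial (X : (ZMod 5)⟦X⟧) n ^ 2 =
      ∑ k ∈ Finset.range (2 * n + 1), X ^ t k * ((-1) ^ k * qBinom X (2 * n + 1) k *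
        ((2 * n + 1 - k : ℕ) : (ZMod 5)⟦X⟧)) := by
    apply mul_left_cancel₀ (pow_ne_zero (n.choose 2 + n ^ 2) (X_ne_zero (R := ZMod 5)))
    rw [Finset.mul_sum, mul_left_comm, ← mul_assoc, ← sum_qBinom_eq_qFactorial_sq]
    refine Finset.sum_congr rfl fun k hk => ?_
    rw [ht1 k (Finset.mem_range.1 hk), pow_add]
    ring
  have hcube : X ^ (n + 1) ∣ e ^ 3 - e * qFactorial X n ^ 2 := by
    rw [show e ^ 3 - e * qFactorial X n ^ 2 =
      (e - qFactorial X n) * (e * (e + qFactorial X n)) by ring]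
    exact (X_pow_dvd_pentagonalSeries_sub n).mul_right _
  rw [coeff_eq_of_X_pow_dvd_sub hcube (by omega)]
  have : e * qFactorial X n ^ 2 = (-1) ^ n * ∑ k ∈ Finset.range (2 * n + 1),
      C ((-1) ^ k * ((2 * n + 1 - k : ℕ) : ZMod 5)) *
        (X ^ t k * (e * qBinom X (2 * n + 1) k)) := by
    have hC (k : ℕ) : C ((-1) ^ k * ((2 * n + 1 - k : ℕ) : ZMod 5)) =
      (-1) ^ k * ((2 * n + 1 - k : ℕ) : (ZMod 5)⟦X⟧) := by simp
    have h2 := congrArg (fun p => (-1) ^ n * (e * p)) hsum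
    rw [Finset.mul_sum] at h2
    simp only [hC]
    have h3 : (-1 : (ZMod 5)⟦X⟧) ^ n * (-1) ^ n = 1 := by rw [← mul_pow]; simp
    calc _ = (-1) ^ n * (e * ((-1) ^ n * qFactorial X n ^ 2)) := by
          linear_combination (-(e * qFactorial X n ^ 2)) * h3
      _ = _ := by
          rw [h2]
          congr 1
          exact Finset.sum_congr rfl fun k _ => by ring
  rw [this, show ((-1) ^ n : (ZMod 5)⟦X⟧) = C ((-1) ^ n) by simp, coeff_C_mul, map_sum,
    Finset.sum_eq_zero, mul_zero]
  intro k hk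
  rw [Finset.mem_range] at hk
  rw [coeff_C_mul]
  have hdvd : X ^ (n + 1) ∣ X ^ t k * (e * qBinom X (2 * n + 1) k) - X ^ t k := by
    obtain ⟨j, hj⟩ := Nat.exists_eq_add_of_le (show k ≤ 2 * n + 1 by omega)
    have h3 := ht2 k hk
    rw [hj, show k + j - k = j by omega] at h3
    have h2 := X_pow_dvd_pentagonalSeries_mul_qBinom_sub_one (R := ZMod 5)
      (min_le_left k j) (min_le_right k j)
    rw [← hj, ← he] at h2
    rw [show X ^ t k * (e * qBinom X (2 * n + 1) k) - X ^ t k =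
      X ^ t k * (e * qBinom X (2 * n + 1) k - 1) by ring]
    have h4 := mul_dvd_mul_left (X ^ t k) h2
    rw [← pow_add] at h4
    exact (pow_dvd_pow X (by omega)).trans h4
  rw [coeff_eq_of_X_pow_dvd_sub hdvd (by omega), coeff_X_pow]
  split_ifs with hmt
  · have h2 : (2 * (t k : ℕ) : ZMod 5) = (n - k) * (n - k + 1) := by
      exact_mod_cast congrArg (Int.cast (R := ZMod 5)) (ht3 k hk)
    rw [← hmt, hn] at h2
    have hk0 : (k : ZMod 5) = 0 := by
      revert h0 h1 h2
      generalize (m : ZMod 5) = a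
      generalize (k : ZMod 5) = b
      revert a b
      decide
    have : ((2 * n + 1 - k : ℕ) : ZMod 5) = 0 := by
      rw [Nat.cast_sub (by omega)]
      push_cast
      rw [hn, hk0]
      rfl
    rw [this]
    simp
  · rw [mul_zero]

section Jacobi

local notation "θ" => eulerD (ZMod 5)

theorem eulerD_eulerD_pentagonalSeries_cube :
    θ (θ (pentagonalSeries (ZMod 5) ^ 3)) = θ (pentagonalSeries (ZMod 5) ^ 3) := by
  ext m
  rw [coeff_eulerD, coeff_eulerD]
  by_cases h0 : (m : ZMod 5) = 0
  · simp [h0]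
  by_cases h1 : (m : ZMod 5) = 1
  · simp [h1]
  simp [coeff_pentagonalSeries_cube h0 h1]

theorem eulerD_eulerD_expand_pentagonalSeries_cube :
    θ (θ (expand 2 two_ne_zero (pentagonalSeries (ZMod 5)) ^ 3)) =
      2 * θ (expand 2 two_ne_zero (pentagonalSeries (ZMod 5)) ^ 3) := by
  rw [← map_pow, eulerD_expand_two, eulerD_two_mul, eulerD_expand_two,
    eulerD_eulerD_pentagonalSeries_cube]

end Jacobi

section Gauss

theorem sum_range_odd (n : ℕ) : ∑ i ∈ Finset.range n, (2 * i + 1) = n ^ 2 := by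
  induction n with
  | zero => rfl
  | succ n ih =>
    rw [Finset.sum_range_succ, ih]
    ring

theorem sum_qBinom_sq_eq_prod {R : Type*} [CommRing R] (q : R) (n : ℕ) :
    ∑ k ∈ Finset.range (2 * n + 1), q ^ (k ^ 2 + 2 * n * (2 * n - k)) * (-1) ^ k *
      qBinom (q ^ 2) (2 * n) k =
    (-1) ^ n * q ^ (3 * n ^ 2) * (∏ i ∈ Finset.range n, (1 - q ^ (2 * i + 1))) ^ 2 := by
  have h := prod_add_mul_pow (q ^ 2) (-q) (q ^ (2 * n)) (2 * n)
  have hterm (k : ℕ) : (q ^ 2) ^ k.choose 2 * qBinom (q ^ 2) (2 * n) k * (-q) ^ k *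
      (q ^ (2 * n)) ^ (2 * n - k) =
      q ^ (k ^ 2 + 2 * n * (2 * n - k)) * (-1) ^ k * qBinom (q ^ 2) (2 * n) k := by
    have hk : k ^ 2 = 2 * k.choose 2 + k := by
      zify
      rw [two_mul_choose_two]
      ring
    rw [hk, neg_pow q k]
    ring
  simp only [hterm] at h
  rw [← h, two_mul n, Finset.prod_range_add]
  have h1 : ((-1) ^ n : R) = ∏ i ∈ Finset.range n, (-1 : R) := by simp
  have h2 : q ^ (2 * n ^ 2) = ∏ i ∈ Finset.range n, q ^ (2 * n) := by
    rw [Finset.prod_const, Finset.card_range]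
    ring
  have h3 : q ^ n ^ 2 = ∏ i ∈ Finset.range n, q ^ (2 * i + 1) := by
    rw [Finset.prod_pow_eq_pow_sum, sum_range_odd]
  have hA : ∏ i ∈ Finset.range n, (q ^ (n + n) + -q * (q ^ 2) ^ i) =
      (-1) ^ n * q ^ n ^ 2 * ∏ i ∈ Finset.range n, (1 - q ^ (2 * i + 1)) := by
    rw [h1, h3, ← Finset.prod_range_reflect (fun i => 1 - q ^ (2 * i + 1)),
      ← Finset.prod_mul_distrib, ← Finset.prod_mul_distrib]
    refine Finset.prod_congr rfl fun i hi => ?_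
    obtain ⟨j, rfl⟩ := Nat.exists_eq_add_of_lt (Finset.mem_range.1 hi)
    rw [show i + j + 1 - 1 - i = j by omega]
    ring
  have hB : ∏ i ∈ Finset.range n, (q ^ (n + n) + -q * (q ^ 2) ^ (n + i)) =
      q ^ (2 * n ^ 2) * ∏ i ∈ Finset.range n, (1 - q ^ (2 * i + 1)) := by
    rw [h2, ← Finset.prod_mul_distrib]
    exact Finset.prod_congr rfl fun i _ => by ring
  rw [hA, hB]
  ring

theorem prod_odd_mul_qFactorial_sq {R : Type*} [CommRing R] (q : R) (n : ℕ) :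
    (∏ i ∈ Finset.range n, (1 - q ^ (2 * i + 1))) * qFactorial (q ^ 2) n =
      qFactorial q (2 * n) := by
  induction n with
  | zero => simp [qFactorial]
  | succ n ih =>
    rw [show 2 * (n + 1) = 2 * n + 1 + 1 by ring, qFactorial_succ, qFactorial_succ,
      qFactorial_succ, Finset.prod_range_succ, ← ih]
    ring

theorem gauss_exponent {n k : ℕ} (hk : k < 2 * n + 1) :
    k ^ 2 + 2 * n * (2 * n - k) = 3 * n ^ 2 + (k - n : ℤ).natAbs ^ 2 := by
  zify [Nat.lt_succ_iff.1 hk]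
  rw [sq_abs]
  ring

local notation "e" => pentagonalSeries (ZMod 5)
local notation "d" => expand 2 two_ne_zero (pentagonalSeries (ZMod 5))

theorem X_pow_dvd_expand {f : (ZMod 5)⟦X⟧} {n : ℕ} (h : X ^ n ∣ f) :
    X ^ (2 * n) ∣ expand 2 two_ne_zero f := by
  have := map_dvd (expand 2 two_ne_zero) h
  rwa [map_pow, expand_X, ← pow_mul] at this

theorem X_pow_dvd_sub_sum {f : (ZMod 5)⟦X⟧} (hf : f * d = e ^ 2) (n : ℕ) :
    X ^ (n + 1) ∣ f - (-1) ^ n * ∑ k ∈ Finset.range (2 * n + 1),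
      (-1) ^ k * X ^ (k - n : ℤ).natAbs ^ 2 := by
  set P : (ZMod 5)⟦X⟧ := ∏ i ∈ Finset.range n, (1 - X ^ (2 * i + 1))
  have hd : IsUnit d := isUnit_pentagonalSeries.map (expand 2 two_ne_zero)
  have hXF : expand 2 two_ne_zero (qFactorial X n) = qFactorial (X ^ 2 : (ZMod 5)⟦X⟧) n := by
    have := map_qFactorial (expand 2 two_ne_zero : (ZMod 5)⟦X⟧ →ₐ[ZMod 5] _).toRingHom X n
    simpa [expand_X] using this
  have hXB (N k : ℕ) : expand 2 two_ne_zero (qBinom X N k) =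
      qBinom (X ^ 2 : (ZMod 5)⟦X⟧) N k := by
    have := map_qBinom (expand 2 two_ne_zero : (ZMod 5)⟦X⟧ →ₐ[ZMod 5] _).toRingHom X N k
    simpa [expand_X] using this
  have h1 : X ^ (n + 1) ∣ P * d - e := by
    have h2 : X ^ (n + 1) ∣ d - qFactorial (X ^ 2) n := by
      rw [← hXF, ← map_sub]
      exact (pow_dvd_pow X (by omega)).trans
        (X_pow_dvd_expand (X_pow_dvd_pentagonalSeries_sub n))
    have h3 : X ^ (n + 1) ∣ e - qFactorial X (2 * n) :=
      (pow_dvd_pow X (by omega)).trans (X_pow_dvd_pentagonalSeries_sub (2 * n))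
    rw [← prod_odd_mul_qFactorial_sq] at h3
    have := dvd_sub (h2.mul_left P) h3
    convert this using 1
    ring
  have h4 : X ^ (n + 1) ∣ f - d * P ^ 2 := by
    rw [← hd.dvd_mul_right, show (f - d * P ^ 2) * d = -((P * d - e) * (P * d + e)) by
      linear_combination hf, dvd_neg]
    exact h1.mul_right _
  have hsum : (-1) ^ n * P ^ 2 = ∑ k ∈ Finset.range (2 * n + 1),
      X ^ (k - n : ℤ).natAbs ^ 2 * ((-1) ^ k * qBinom (X ^ 2) (2 * n) k) := by
    apply mul_left_cancel₀ (pow_ne_zero (3 * n ^ 2) (X_ne_zero (R := ZMod 5)))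
    rw [Finset.mul_sum, mul_left_comm, ← mul_assoc, ← sum_qBinom_sq_eq_prod]
    refine Finset.sum_congr rfl fun k hk => ?_
    rw [gauss_exponent (Finset.mem_range.1 hk), pow_add]
    ring
  have h5 : d * P ^ 2 = (-1) ^ n * ∑ k ∈ Finset.range (2 * n + 1),
      (-1) ^ k * (X ^ (k - n : ℤ).natAbs ^ 2 * (d * qBinom (X ^ 2) (2 * n) k)) := by
    have h3 : (-1 : (ZMod 5)⟦X⟧) ^ n * (-1) ^ n = 1 := by rw [← mul_pow]; simp
    calc _ = (-1) ^ n * (d * ((-1) ^ n * P ^ 2)) := by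
          linear_combination (-(d * P ^ 2)) * h3
      _ = _ := by
          rw [hsum, Finset.mul_sum]
          congr 1
          exact Finset.sum_congr rfl fun k _ => by ring
  have h6 : X ^ (n + 1) ∣ d * P ^ 2 - (-1) ^ n * ∑ k ∈ Finset.range (2 * n + 1),
      (-1) ^ k * X ^ (k - n : ℤ).natAbs ^ 2 := by
    rw [h5, ← mul_sub, ← Finset.sum_sub_distrib]
    refine Dvd.dvd.mul_left (Finset.dvd_sum fun k hk => ?_) _
    rw [← mul_sub]
    refine Dvd.dvd.mul_left ?_ _
    rw [show ∀ a b : (ZMod 5)⟦X⟧, a * b - a = a * (b - 1) by intros; ring]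
    rw [Finset.mem_range] at hk
    obtain ⟨j, hj⟩ := Nat.exists_eq_add_of_le (show k ≤ 2 * n by omega)
    have h2 := X_pow_dvd_expand (X_pow_dvd_pentagonalSeries_mul_qBinom_sub_one (R := ZMod 5)
      (min_le_left k j) (min_le_right k j))
    rw [map_sub, map_mul, map_one, hXB, ← hj] at h2
    have h7 := mul_dvd_mul_left (X ^ (k - n : ℤ).natAbs ^ 2) h2
    rw [← pow_add] at h7
    refine (pow_dvd_pow X ?_).trans h7
    have : (k - n : ℤ).natAbs ≤ (k - n : ℤ).natAbs ^ 2 := Nat.le_self_pow two_ne_zero _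
    omega
  have := dvd_add h4 h6
  rwa [sub_add_sub_cancel] at this

theorem sum_alternating_squares (n : ℕ) :
    (-1) ^ n * ∑ k ∈ Finset.range (2 * n + 1), (-1) ^ k * X ^ (k - n : ℤ).natAbs ^ 2 =
      (1 + ∑ j ∈ Finset.range n, C (2 * (-1) ^ (j + 1)) * X ^ (j + 1) ^ 2 : (ZMod 5)⟦X⟧) := by
  have h3 : (-1 : (ZMod 5)⟦X⟧) ^ n * (-1) ^ n = 1 := by rw [← mul_pow]; simp
  rw [show 2 * n + 1 = n + (n + 1) by ring, Finset.sum_range_add, Finset.sum_range_succ',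
    ← Finset.sum_range_reflect, ← add_assoc, ← Finset.sum_add_distrib, mul_add, Finset.mul_sum,
    add_comm]
  congr 1
  · simp [h3]
  refine Finset.sum_congr rfl fun j hj => ?_
  obtain ⟨i, rfl⟩ := Nat.exists_eq_add_of_lt (Finset.mem_range.1 hj)
  have h4 : ((j + i + 1 - 1 - j : ℕ) - (j + i + 1 : ℕ) : ℤ).natAbs = j + 1 := by omega
  have h5 : ((j + i + 1 + (j + 1) : ℕ) - (j + i + 1 : ℕ) : ℤ).natAbs = j + 1 := by omega
  have h6 : (-1 : (ZMod 5)⟦X⟧) ^ (j + i + 1) * (-1) ^ i = (-1) ^ (j + 1) := by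
    rw [← pow_add, show j + i + 1 + i = j + 1 + 2 * i by ring, pow_add, pow_mul]
    simp
  have h2 : C (2 * (-1) ^ (j + 1) : ZMod 5) = 2 * (-1) ^ (j + 1) := by
    rw [map_mul, map_ofNat, map_pow, map_neg, map_one]
  rw [h4, h5, h2, show j + i + 1 - 1 - j = i by omega, pow_add _ (j + i + 1) (j + 1)]
  linear_combination X ^ (j + 1) ^ 2 * h6 + (-1) ^ (j + 1) * X ^ (j + 1) ^ 2 * h3

theorem coeff_of_mul_eq_sq {f : (ZMod 5)⟦X⟧} (hf : f * d = e ^ 2) (m : ℕ) :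
    coeff m f = if m = 0 then 1 else if IsSquare m then 2 * (-1) ^ m else 0 := by
  rw [coeff_eq_of_X_pow_dvd_sub (X_pow_dvd_sub_sum hf m) m.lt_succ_self,
    sum_alternating_squares, map_add, map_sum, coeff_one]
  simp only [coeff_C_mul, coeff_X_pow]
  split_ifs with h0 hsq
  · simp [h0]
  · obtain ⟨r, rfl⟩ := hsq
    have hr : 0 < r := Nat.pos_of_ne_zero fun h => h0 (by simp [h])
    rw [zero_add, Finset.sum_eq_single (r - 1), Nat.sub_add_cancel hr, if_pos (sq r).symm, mul_one,
      pow_mul]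
    · rcases r.even_or_odd with h | h <;> simp [h.neg_one_pow]
    · intro j _ hj
      rw [if_neg, mul_zero]
      intro h
      rw [← sq] at h
      have := Nat.pow_left_injective (two_ne_zero) h
      omega
    · intro h
      rw [Finset.mem_range] at h
      have := Nat.le_mul_self r
      omega
  · rw [zero_add]
    refine Finset.sum_eq_zero fun j _ => ?_
    rw [if_neg, mul_zero]
    rintro rfl
    exact hsq ⟨j + 1, sq _⟩

local notation "θ" => eulerD (ZMod 5)

theorem eulerD_eulerD_of_mul_eq_sq {f : (ZMod 5)⟦X⟧} (hf : f * d = e ^ 2) :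
    θ (θ f) = f - f ^ 25 := by
  ext m
  rw [coeff_eulerD, coeff_eulerD, map_sub, ← expand_twentyFive_eq_pow, coeff_expand,
    coeff_of_mul_eq_sq hf, coeff_of_mul_eq_sq hf]
  by_cases h0 : m = 0
  · simp [h0]
  by_cases hsq : IsSquare m
  · obtain ⟨s, rfl⟩ := hsq
    have hs : s ≠ 0 := by rintro rfl; simp at h0
    by_cases h5 : 5 ∣ s
    · obtain ⟨t, rfl⟩ := h5
      have ht : t ≠ 0 := by rintro rfl; simp at hs
      have h1 : 5 * t * (5 * t) / 25 = t * t := by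
        rw [show 5 * t * (5 * t) = 25 * (t * t) by ring, Nat.mul_div_cancel_left _ (by norm_num)]
      have h2 : (25 : ℕ) ∣ 5 * t * (5 * t) := ⟨t * t, by ring⟩
      have h3 : (((5 * t * (5 * t) : ℕ)) : ZMod 5) = 0 := by
        push_cast
        rw [show (5 : ZMod 5) = 0 from rfl]
        ring
      have h4 : (-1 : ZMod 5) ^ (5 * t * (5 * t)) = (-1) ^ (t * t) := by
        rw [show 5 * t * (5 * t) = t * t + 2 * (12 * (t * t)) by ring, pow_add, pow_mul _ 2]
        simp
      rw [if_pos h2, h1, if_neg h0, if_pos ⟨_, rfl⟩, if_neg (mul_ne_zero ht ht), if_pos ⟨_, rfl⟩,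
        h3, h4]
      ring
    · have h2 : ¬ 25 ∣ s * s := by
        intro h
        exact h5 ((Nat.Prime.dvd_mul (by norm_num)).1 ((by norm_num : 5 ∣ 25).trans h)
          |>.elim id id)
      rw [if_neg h2, if_neg h0, if_pos ⟨_, rfl⟩]
      have h3 : (s : ZMod 5) ≠ 0 := by rwa [Ne, ZMod.natCast_eq_zero_iff]
      have h4 : (s : ZMod 5) ^ 4 = 1 := ZMod.pow_card_sub_one_eq_one h3
      push_cast
      linear_combination 2 * (-1) ^ (s * s) * h4
  · have h1 (p : ℕ) (hp : m = 25 * p) : ¬ IsSquare p := by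
      rintro ⟨t, rfl⟩
      exact hsq ⟨5 * t, by rw [hp]; ring⟩
    rw [if_neg h0, if_neg hsq]
    split_ifs with h2 h3 h4
    · obtain ⟨p, rfl⟩ := h2
      omega
    · obtain ⟨p, rfl⟩ := h2
      rw [Nat.mul_div_cancel_left _ (by norm_num)] at h4
      exact absurd h4 (h1 p rfl)
    · simp
    · simp

end Gauss

section GeneratingFunction

open scoped PowerSeries.WithPiTopology

variable {R : Type*} [CommRing R] [TopologicalSpace R]

theorem mk_card_restricted_mul_eq_one [IsTopologicalRing R] [T2Space R]
    {p : ℕ → Prop} [DecidablePred p] {D : R⟦X⟧}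
    (hD : HasProd (fun i => if p (i + 1) then 1 - X ^ (i + 1) else 1) D) :
    PowerSeries.mk (fun n => ((Nat.Partition.restricted n p).card : R)) * D = 1 := by
  refine ((Nat.Partition.hasProd_powerSeriesMk_card_restricted R p).mul hD).unique ?_
  convert! hasProd_one using 2 with i
  split_ifs
  · simp_rw [pow_mul]
    exact WithPiTopology.tsum_pow_mul_one_sub_of_constantCoeff_eq_zero (by simp)
  · rw [one_mul]

theorem hasProd_one_sub_X_pow_two_mul :
    HasProd (fun i => (1 - X ^ (2 * (i + 1)) : R⟦X⟧))
      (expand 2 two_ne_zero (pentagonalSeries R)) := by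
  rw [HasProd, WithPiTopology.tendsto_iff_coeff_tendsto]
  intro n
  apply tendsto_nhds_of_eventually_eq
  simp only [SummationFilter.unconditional_filter]
  filter_upwards [coeff_prod_one_sub_X_pow_eventually_eq R (n / 2)] with s hs
  have : ∏ i ∈ s, (1 - X ^ (2 * (i + 1)) : R⟦X⟧) =
      expand 2 two_ne_zero (∏ i ∈ s, (1 - X ^ (i + 1))) := by
    rw [map_prod]
    refine Finset.prod_congr rfl fun i _ => ?_
    rw [map_sub, map_one, map_pow, expand_X, pow_mul]
  rw [this, coeff_expand, coeff_expand, hs]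

theorem hasProd_even_one_sub_X_pow :
    HasProd (fun i => if Even (i + 1) then (1 - X ^ (i + 1) : R⟦X⟧) else 1)
      (expand 2 two_ne_zero (pentagonalSeries R)) := by
  have hinj : Function.Injective fun i : ℕ => 2 * i + 1 := fun i j h => by
    simpa using h
  rw [← hinj.hasProd_iff]
  · convert! hasProd_one_sub_X_pow_two_mul (R := R) using 2 with i
    simp only [Function.comp_apply]
    rw [if_pos ⟨i + 1, by ring⟩, show 2 * i + 1 + 1 = 2 * (i + 1) by ring]
  · intro i hi
    rw [if_neg]
    rintro ⟨k, hk⟩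
    exact hi ⟨k - 1, by simp only; omega⟩

end GeneratingFunction

theorem mk_cubicPartition_mul_eq_one :
    PowerSeries.mk (fun n => (cubicPartition n : ZMod 5)) *
      (pentagonalSeries (ZMod 5) * expand 2 two_ne_zero (pentagonalSeries (ZMod 5))) = 1 := by
  let _ : TopologicalSpace (ZMod 5) := ⊥
  have : DiscreteTopology (ZMod 5) := ⟨rfl⟩
  have h1 := mk_card_restricted_mul_eq_one (R := ZMod 5) (p := fun _ => True)
    (D := pentagonalSeries (ZMod 5))
    (by simpa using WithPiTopology.hasProd_one_sub_X_pow (ZMod 5))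
  have h2 := mk_card_restricted_mul_eq_one (hasProd_even_one_sub_X_pow (R := ZMod 5))
  have h3 : PowerSeries.mk (fun n => (cubicPartition n : ZMod 5)) =
      PowerSeries.mk (fun n => ((Nat.Partition.restricted n fun _ => True).card : ZMod 5)) *
      PowerSeries.mk (fun n => ((Nat.Partition.restricted n Even).card : ZMod 5)) := by
    ext n
    rw [coeff_mul, Finset.Nat.sum_antidiagonal_eq_sum_range_succ_mk]
    simp only [coeff_mk, cubicPartition, Nat.cast_sum, Nat.cast_mul]
    refine Finset.sum_congr rfl fun j _ => ?_
    rw [Fintype.card_subtype]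
    simp [Nat.Partition.restricted]
  rw [h3, mul_mul_mul_comm, h1, h2, one_mul]

theorem cubicPartition_mod_five (n : ℕ) : 5 ∣ cubicPartition (25 * n + 22) := by
  rw [← ZMod.natCast_eq_zero_iff]
  have hu : IsUnit (expand 2 two_ne_zero (pentagonalSeries (ZMod 5))) :=
    isUnit_pentagonalSeries.map (expand 2 two_ne_zero)
  obtain ⟨c, hc⟩ := hu.exists_left_inv
  have hf : pentagonalSeries (ZMod 5) ^ 2 * c *
      expand 2 two_ne_zero (pentagonalSeries (ZMod 5)) = pentagonalSeries (ZMod 5) ^ 2 := by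
    rw [mul_assoc, hc, mul_one]
  have := coeff_eq_zero_of_dissection constantCoeff_pentagonalSeries
    (by rw [constantCoeff_expand, constantCoeff_pentagonalSeries])
    eulerD_eulerD_pentagonalSeries eulerD_eulerD_expand_pentagonalSeries
    eulerD_eulerD_pentagonalSeries_cube eulerD_eulerD_expand_pentagonalSeries_cube
    hf (eulerD_eulerD_of_mul_eq_sq hf) mk_cubicPartition_mul_eq_one n
  rwa [coeff_mk] at this
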